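/- Let f : (ℤ/2ℤ) × (ℤ/2ℤ) × ℍ → ℂ be defined by f(0,0;τ) = −24, f(0,1;τ) = f_R(τ), f(1,0;τ) = f̃_NS(τ), f(1,1;τ) = −f_NS(τ). Then for every matrix (a b; c d) ∈ SL(2,ℤ), every x, y ∈ ℤ/2ℤ, and every τ ∈ ℍ, one has f(x, y; (aτ+b)/(cτ+d)) = f(a·x + c·y, b·x + d·y; τ), where the matrix entries are reduced modulo 2. -/

import Mathlib

open scoped Real

/-- The Dedekind eta function `η(τ) = e^{πiτ/12} ∏_{n=1}^∞ (1 - e^{2πinτ})`. -/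
noncomputable def eta (τ : ℂ) : ℂ :=
  Complex.exp (Real.pi * Complex.I * τ / 12) *
    ∏' n : ℕ, (1 - Complex.exp (2 * Real.pi * Complex.I * (n + 1) * τ))

/-- `f_NS(τ) = η(τ)^48/(η(τ/2)^24 η(2τ)^24) − 24`. -/
noncomputable def fNS (τ : ℂ) : ℂ :=
  eta τ ^ 48 / (eta (τ / 2) ^ 24 * eta (2 * τ) ^ 24) - 24

/-- `f̃_NS(τ) = η(τ/2)^24/η(τ)^24 + 24`. -/
noncomputable def ftNS (τ : ℂ) : ℂ :=
  eta (τ / 2) ^ 24 / eta τ ^ 24 + 24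

/-- `f_R(τ) = 2^12 η(2τ)^24/η(τ)^24 + 24`. -/
noncomputable def fR (τ : ℂ) : ℂ :=
  2 ^ 12 * eta (2 * τ) ^ 24 / eta τ ^ 24 + 24

/-- The function `f : (ℤ/2) × (ℤ/2) × ℍ → ℂ` with `f(0,0) = −24`, `f(0,1) = f_R`,
    `f(1,0) = f̃_NS`, `f(1,1) = −f_NS`. -/
noncomputable def fconway (x y : ZMod 2) (τ : ℂ) : ℂ :=
  if x = 0 then (if y = 0 then -24 else fR τ)
  else (if y = 0 then ftNS τ else -fNS τ)

lemma my_eta_eq (z : ℂ) : eta z = ModularForm.eta z := by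
  unfold eta ModularForm.eta
  congr 1
  · unfold Function.Periodic.qParam
    congr 1
    push_cast
    ring
  · congr 1
    ext n
    rw [ModularForm.eta_q_eq_cexp]

/-- the 24th power of eta -/
noncomputable def my_D (z : ℂ) : ℂ := eta z ^ 24

lemma my_D_ne {z : ℂ} (hz : 0 < z.im) : my_D z ≠ 0 := by
  unfold my_D
  rw [my_eta_eq]
  exact pow_ne_zero _ (ModularForm.eta_ne_zero hz)

/-- Euler product -/
noncomputable def my_phi (q : ℂ) : ℂ := ∏' n : ℕ, (1 - q ^ (n + 1))

/-- odd Euler product -/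
noncomputable def my_psi (q : ℂ) : ℂ := ∏' n : ℕ, (1 - q ^ (2 * n + 1))

lemma my_D_eq (z : ℂ) : my_D z = Complex.exp (2 * π * Complex.I * z) *
    my_phi (Complex.exp (2 * π * Complex.I * z)) ^ 24 := by
  unfold my_D eta my_phi
  rw [mul_pow, ← Complex.exp_nat_mul]
  congr 2
  · push_cast; ring
  · congr 1
    ext n
    rw [← Complex.exp_nat_mul]
    push_cast
    ring_nf

lemma my_D_add_one (z : ℂ) : my_D (z + 1) = my_D z := by
  have : Complex.exp (2 * π * Complex.I * (z + 1)) = Complex.exp (2 * π * Complex.I * z) := by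
    rw [mul_add, mul_one, Complex.exp_add, Complex.exp_two_pi_mul_I, mul_one]
  rw [my_D_eq, my_D_eq, this]

lemma my_D_S {z : ℂ} (hz : 0 < z.im) : my_D (-1 / z) = z ^ 12 * my_D z := by
  have h := congrFun ModularForm.discriminant_S_invariant (⟨z, hz⟩ : UpperHalfPlane)
  have hz0 : z ≠ 0 := by rintro rfl; simp at hz
  rw [ModularForm.SL_slash_apply, UpperHalfPlane.modular_S_smul, ModularGroup.denom_S] at h
  simp [ModularForm.discriminant] at h
  unfold my_D
  rw [my_eta_eq, my_eta_eq, ← h, show -1 / z = -z⁻¹ by ring]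
  field_simp

lemma my_mult_odd {q : ℂ} (hq : ‖q‖ < 1) : Multipliable fun n : ℕ ↦ 1 - q ^ (2 * n + 1) := by
  apply multipliable_one_add_of_summable (f := fun n ↦ -q ^ (2 * n + 1))
  have := (summable_geometric_of_lt_one (norm_nonneg _) hq).comp_injective
    (i := fun n : ℕ => 2 * n + 1) (fun a b h => by simpa using h)
  simpa [Function.comp_def] using this

lemma my_phi_split {q : ℂ} (hq : ‖q‖ < 1) : my_phi q = my_psi q * my_phi (q ^ 2) := by
  have hq2 : ‖q ^ 2‖ < 1 := by
    rw [norm_pow]; exact pow_lt_one₀ (norm_nonneg _) hq two_ne_zero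
  have h := tprod_even_mul_odd (f := fun n : ℕ => 1 - q ^ (n + 1)) (my_mult_odd hq)
    ((ModularForm.multipliable_one_sub_pow hq2).congr fun n => by rw [← pow_mul]; ring_nf)
  unfold my_phi my_psi
  rw [← h]
  congr 1
  congr 1
  ext n
  rw [← pow_mul]; ring_nf

lemma my_psi_mul {q : ℂ} (hq : ‖q‖ < 1) : my_psi q * my_psi (-q) = my_psi (q ^ 2) := by
  unfold my_psi
  rw [← (my_mult_odd hq).tprod_mul (my_mult_odd (by simpa using hq))]
  congr 1
  ext n
  rw [Odd.neg_pow ⟨n, rfl⟩]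
  ring

lemma my_phi_rel {q : ℂ} (hq : ‖q‖ < 1) :
    my_phi (-q) * my_phi q * my_phi (q ^ 4) = my_phi (q ^ 2) ^ 3 := by
  have hq2 : ‖q ^ 2‖ < 1 := by
    rw [norm_pow]; exact pow_lt_one₀ (norm_nonneg _) hq two_ne_zero
  have h1 := my_phi_split hq
  have h2 := my_phi_split (q := -q) (by simpa using hq)
  have h3 := my_phi_split hq2
  have h4 := my_psi_mul hq
  rw [neg_sq] at h2
  rw [← pow_mul] at h3
  norm_num at h3
  rw [h1, h2]
  linear_combination (my_phi (q^2))^2 * my_phi (q^4) * h4 - (my_phi (q^2))^2 * h3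

lemma my_D_rel {z : ℂ} (hz : 0 < z.im) :
    my_D ((z + 1) / 2) * my_D (z / 2) * my_D (2 * z) = - my_D z ^ 3 := by
  set q := Complex.exp (2 * π * Complex.I * (z / 2)) with hqd
  have hq : ‖q‖ < 1 := UpperHalfPlane.norm_exp_two_pi_I_lt_one
    (⟨z / 2, by simpa using hz⟩ : UpperHalfPlane)
  have e1 : Complex.exp (2 * π * Complex.I * ((z + 1) / 2)) = -q := by
    rw [show 2 * π * Complex.I * ((z + 1) / 2) = 2 * π * Complex.I * (z / 2) + π * Complex.I by
      ring, Complex.exp_add, Complex.exp_pi_mul_I, hqd]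
    ring
  have e2 : Complex.exp (2 * π * Complex.I * z) = q ^ 2 := by
    rw [hqd, ← Complex.exp_nat_mul]; push_cast; ring_nf
  have e4 : Complex.exp (2 * π * Complex.I * (2 * z)) = q ^ 4 := by
    rw [hqd, ← Complex.exp_nat_mul]; push_cast; ring_nf
  rw [my_D_eq, my_D_eq (z / 2), my_D_eq (2 * z), my_D_eq z, e1, e2, e4, ← hqd]
  have h := congrArg (· ^ 24) (my_phi_rel hq)
  simp only [mul_pow] at h
  linear_combination (-q ^ 6) * h

lemma my_fNS {z : ℂ} (hz : 0 < z.im) : -fNS z = my_D ((z + 1) / 2) / my_D z + 24 := by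
  have h1 := my_D_ne hz
  have h2 : my_D (z / 2) ≠ 0 := my_D_ne (by simpa using hz)
  have h3 : my_D (2 * z) ≠ 0 := my_D_ne (by simpa using hz)
  have h := my_D_rel hz
  have : fNS z = my_D z ^ 2 / (my_D (z / 2) * my_D (2 * z)) - 24 := by
    unfold fNS my_D; rw [← pow_mul]
  rw [this]
  generalize my_D (2 * z) = A at *
  generalize my_D ((z + 1) / 2) = B at *
  field_simp
  linear_combination -h

lemma my_fNS' (z : ℂ) : fNS z = my_D z ^ 2 / (my_D (z / 2) * my_D (2 * z)) - 24 := by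
  unfold fNS my_D; rw [← pow_mul]

lemma my_ftNS (z : ℂ) : ftNS z = my_D (z / 2) / my_D z + 24 := rfl
lemma my_fR (z : ℂ) : fR z = 2 ^ 12 * my_D (2 * z) / my_D z + 24 := rfl

lemma my_fR_T (z : ℂ) : fR (z + 1) = fR z := by
  rw [my_fR, my_fR, my_D_add_one, show 2 * (z + 1) = 2 * z + 1 + 1 by ring, my_D_add_one,
    my_D_add_one]

lemma my_ftNS_T {z : ℂ} (hz : 0 < z.im) : ftNS (z + 1) = -fNS z := by
  rw [my_fNS hz, my_ftNS, my_D_add_one]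

lemma my_fNS_T {z : ℂ} (hz : 0 < z.im) : -fNS (z + 1) = ftNS z := by
  rw [my_fNS (by simpa using hz), my_ftNS, my_D_add_one, show (z + 1 + 1) / 2 = z / 2 + 1 by ring,
    my_D_add_one]

lemma my_D_S1 {z : ℂ} (hz : 0 < z.im) : my_D ((-1 / z) / 2) = (2 * z) ^ 12 * my_D (2 * z) := by
  rw [← my_D_S (by simpa using hz)]
  congr 1
  ring

lemma my_D_S2 {z : ℂ} (hz : 0 < z.im) : my_D (2 * (-1 / z)) = (z / 2) ^ 12 * my_D (z / 2) := by
  rw [← my_D_S (by simpa using hz)]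
  congr 1
  ring

lemma my_fR_S {z : ℂ} (hz : 0 < z.im) : fR (-1 / z) = ftNS z := by
  have hz0 : z ≠ 0 := by rintro rfl; simp at hz
  have h1 := my_D_ne hz
  rw [my_fR, my_ftNS, my_D_S2 hz, my_D_S hz]
  field_simp

lemma my_ftNS_S {z : ℂ} (hz : 0 < z.im) : ftNS (-1 / z) = fR z := by
  have hz0 : z ≠ 0 := by rintro rfl; simp at hz
  have h1 := my_D_ne hz
  rw [my_fR, my_ftNS, my_D_S1 hz, my_D_S hz]
  field_simp

lemma my_fNS_S {z : ℂ} (hz : 0 < z.im) : fNS (-1 / z) = fNS z := by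
  have hz0 : z ≠ 0 := by rintro rfl; simp at hz
  have h2 : my_D (z / 2) ≠ 0 := my_D_ne (by simpa using hz)
  have h3 : my_D (2 * z) ≠ 0 := my_D_ne (by simpa using hz)
  rw [my_fNS', my_fNS', my_D_S1 hz, my_D_S2 hz, my_D_S hz]
  field_simp

/-- reduction mod 2 -/
def my_M (g : Matrix.SpecialLinearGroup (Fin 2) ℤ) : Matrix (Fin 2) (Fin 2) (ZMod 2) :=
  !![((g 0 0 : ℤ) : ZMod 2), ((g 0 1 : ℤ) : ZMod 2); ((g 1 0 : ℤ) : ZMod 2), ((g 1 1 : ℤ) : ZMod 2)]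

lemma my_M_one : my_M 1 = 1 := by
  ext i j
  fin_cases i <;> fin_cases j <;> simp [my_M]

lemma my_M_mul (g h : Matrix.SpecialLinearGroup (Fin 2) ℤ) : my_M (g * h) = my_M g * my_M h := by
  ext i j
  fin_cases i <;> fin_cases j <;>
    simp [my_M, Matrix.mul_apply, Fin.sum_univ_two]

lemma my_M_S : my_M ModularGroup.S = !![0, -1; 1, 0] := by
  simp [my_M, ModularGroup.S]

lemma my_M_T : my_M ModularGroup.T = !![1, 1; 0, 1] := by
  simp [my_M, ModularGroup.T]

open Matrix in
lemma my_main (g : SpecialLinearGroup (Fin 2) ℤ) : ∀ (v : Fin 2 → ZMod 2) (τ : UpperHalfPlane),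
    fconway (v 0) (v 1) ((g • τ : UpperHalfPlane) : ℂ) =
    fconway ((v ᵥ* my_M g) 0)
      ((v ᵥ* my_M g) 1) (τ : ℂ) := by
  have hg : g ∈ Subgroup.closure {ModularGroup.S, ModularGroup.T} := by
    rw [SpecialLinearGroup.SL2Z_generators]; trivial
  induction hg using Subgroup.closure_induction with
  | mem x hx =>
    intro v τ
    have hz : 0 < (τ : ℂ).im := τ.2
    have h01 : ∀ a : ZMod 2, a = 0 ∨ a = 1 := by decide
    have h11 : (1 + 1 : ZMod 2) = 0 := by decide
    rcases hx with rfl | rfl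
    · rw [UpperHalfPlane.modular_S_smul]
      have e : ((UpperHalfPlane.mk (-(τ : ℂ))⁻¹ τ.im_inv_neg_coe_pos : UpperHalfPlane) : ℂ)
        = -1 / (τ : ℂ) := by
        simp [neg_div]
      rw [e]
      rcases h01 (v 0) with h | h <;> rcases h01 (v 1) with h' | h' <;>
        simp [my_M_S, vecMul, dotProduct, Fin.sum_univ_two, h, h', fconway,
          my_fR_S hz, my_ftNS_S hz, my_fNS_S hz]
    · rw [UpperHalfPlane.modular_T_smul]
      have e : (((1 : ℝ) +ᵥ τ : UpperHalfPlane) : ℂ) = (τ : ℂ) + 1 := by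
        simp [add_comm]
      rw [e]
      rcases h01 (v 0) with h | h <;> rcases h01 (v 1) with h' | h' <;>
        simp [my_M_T, vecMul, dotProduct, Fin.sum_univ_two, h, h', fconway, h11,
          my_fR_T, my_ftNS_T hz, my_fNS_T hz]
  | one => intro v τ; simp [my_M_one]
  | mul x y _ _ hx hy =>
    intro v τ
    rw [mul_smul, hx, hy, vecMul_vecMul, my_M_mul]
  | inv x _ hx =>
    intro v τ
    have := hx (v ᵥ* my_M x⁻¹) (x⁻¹ • τ)
    rw [smul_inv_smul, vecMul_vecMul, ← my_M_mul] at this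
    simpa [my_M_one] using this.symm

/-- SL(2,ℤ)-equivariance of the vector-valued function `f`:
    `f(x, y; (aτ+b)/(cτ+d)) = f(ax + cy, bx + dy; τ)`, entries reduced mod 2. -/
theorem statement5 (a b c d : ℤ) (hdet : a * d - b * c = 1)
    (x y : ZMod 2) (τ : ℂ) (hτ : 0 < τ.im) :
    fconway x y ((a * τ + b) / (c * τ + d)) =
      fconway ((a : ZMod 2) * x + (c : ZMod 2) * y)
        ((b : ZMod 2) * x + (d : ZMod 2) * y) τ := by
  let g : Matrix.SpecialLinearGroup (Fin 2) ℤ :=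
    ⟨!![a, b; c, d], by rw [Matrix.det_fin_two_of]; exact hdet⟩
  have h00 : g 0 0 = a := rfl
  have h01 : g 0 1 = b := rfl
  have h10 : g 1 0 = c := rfl
  have h11 : g 1 1 = d := rfl
  have h := my_main g ![x, y] ⟨τ, hτ⟩
  rw [UpperHalfPlane.coe_specialLinearGroup_apply] at h
  simpa [my_M, h00, h01, h10, h11, Matrix.vecMul, dotProduct, Fin.sum_univ_two, mul_comm] using h
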